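/- Let n ≥ 2, let K : 𝔹ⁿ → [0,∞] be measurable and let Φ : [0,∞] → [0,∞] be a non-decreasing convex function with Φ(0) > 0, and suppose that M := (1/Ω_n)·∫_{𝔹ⁿ} Φ(K(x)) dm(x) is finite. Then there exists a measurable set T* ⊂ (0,∞) of Lebesgue measure |T*| ≤ 1/n such that k(e^{−s}) ≤ Φ⁻¹(e^{ns}·M) for every s ∈ (0,∞) \ T*, where k(r) is the average of K over the sphere |x| = r. -/

import Mathlib

open MeasureTheory Metric Set
open scoped ENNReal NNReal

/-- The generalized inverse `Φ⁻¹(τ) = inf{ t : Φ(t) ≥ τ }` of a non-decreasing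
function `Φ : [0,∞] → [0,∞]` (with `inf ∅ = ∞`). -/
noncomputable def genInv (Φ : ℝ≥0∞ → ℝ≥0∞) (τ : ℝ≥0∞) : ℝ≥0∞ :=
  sInf {t : ℝ≥0∞ | τ ≤ Φ t}

/-- The average `k(r)` of `K : 𝔹ⁿ → [0,∞]` over the sphere `|x| = r` with respect
to the `(n-1)`-dimensional surface (Hausdorff) measure. -/
noncomputable def sphereAvg (n : ℕ) (K : EuclideanSpace ℝ (Fin n) → ℝ≥0∞) (r : ℝ) : ℝ≥0∞ :=
  (∫⁻ x in Metric.sphere (0 : EuclideanSpace ℝ (Fin n)) r, K x ∂(μH[(n : ℝ) - 1])) /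
    μH[(n : ℝ) - 1] (Metric.sphere (0 : EuclideanSpace ℝ (Fin n)) r)


section Sphere

variable {E : Type*} [NormedAddCommGroup E] [InnerProductSpace ℝ E] [FiniteDimensional ℝ E]
  [MeasurableSpace E] [BorelSpace E]

/-- The characteristic function of a rotation-invariant measure depends only on the norm. -/
lemma charFun_eq_of_norm_eq {μ : Measure E} (hμ : ∀ e : E ≃ₗᵢ[ℝ] E, μ.map e = μ)
    {t t' : E} (h : ‖t‖ = ‖t'‖) : charFun μ t = charFun μ t' := by
  let e := Submodule.reflection (ℝ ∙ (t - t'))ᗮ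
  have he : e t = t' := Submodule.reflection_sub h
  conv_rhs => rw [← hμ e]
  rw [charFun_apply, charFun_apply, integral_map e.continuous.aemeasurable (by fun_prop)]
  refine integral_congr_ae (.of_forall fun x => ?_)
  simp only
  rw [← he, e.inner_map_map]

/-- A rotation-invariant probability measure on a sphere is unique. -/
lemma eq_of_map_linearIsometryEquiv_eq {μ ν : Measure E} [IsProbabilityMeasure μ]
    [IsProbabilityMeasure ν] (hμ : ∀ e : E ≃ₗᵢ[ℝ] E, μ.map e = μ)
    (hν : ∀ e : E ≃ₗᵢ[ℝ] E, ν.map e = ν) {r : ℝ} (hr : 0 < r)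
    (hμr : ∀ᵐ x ∂μ, ‖x‖ = r) (hνr : ∀ᵐ x ∂ν, ‖x‖ = r) : μ = ν := by
  refine Measure.ext_of_charFun (funext fun t => ?_)
  have key : ∀ {ρ : Measure E}, (∀ᵐ x ∂ρ, ‖x‖ = r) →
      ∀ᵐ x ∂ρ, ‖t‖ = ‖(‖t‖ / r) • x‖ := by
    intro ρ hρ
    filter_upwards [hρ] with x hx
    rw [norm_smul, hx, norm_div, norm_norm, Real.norm_of_nonneg hr.le, div_mul_cancel₀ _ hr.ne']
  calc charFun μ t = ∫ _y, charFun μ t ∂ν := by simp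
    _ = ∫ y, charFun μ ((‖t‖ / r) • y) ∂ν :=
      integral_congr_ae ((key hνr).mono fun y hy => charFun_eq_of_norm_eq hμ hy)
    _ = ∫ y, ∫ x, Complex.exp (inner ℝ x ((‖t‖ / r) • y) * Complex.I) ∂μ ∂ν := rfl
    _ = ∫ x, ∫ y, Complex.exp (inner ℝ x ((‖t‖ / r) • y) * Complex.I) ∂ν ∂μ := by
      refine integral_integral_swap ?_
      refine Integrable.of_bound (C := 1) (Continuous.aestronglyMeasurable ?_)
        (.of_forall fun p => ?_)
      · simp only [Function.uncurry_def]; fun_prop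
      · simp only [Function.uncurry_def, Complex.norm_exp_ofReal_mul_I, le_refl]
    _ = ∫ x, charFun ν ((‖t‖ / r) • x) ∂μ := by
      refine integral_congr_ae (.of_forall fun x => integral_congr_ae (.of_forall fun y => ?_))
      simp only [real_inner_smul_right, real_inner_comm]
    _ = ∫ _x, charFun ν t ∂μ :=
      integral_congr_ae ((key hμr).mono fun y hy => (charFun_eq_of_norm_eq hν hy).symm)
    _ = charFun ν t := by simp

variable (E) in
/-- The uniform probability distribution on the unit sphere, as a measure on the ambient space. -/
noncomputable def uniformSphere : Measure E :=
  ((volume : Measure E).toSphere univ)⁻¹ • ((volume : Measure E).toSphere.map Subtype.val)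

instance [Nontrivial E] : IsProbabilityMeasure (uniformSphere E) where
  measure_univ := by
    rw [uniformSphere, Measure.smul_apply, Measure.map_apply measurable_subtype_coe .univ,
      preimage_univ, smul_eq_mul]
    exact ENNReal.inv_mul_cancel (Measure.measure_univ_ne_zero.2 (volume : Measure E).toSphere_ne_zero)
      (measure_ne_top _ _)

lemma ae_uniformSphere_norm_eq_one : ∀ᵐ x ∂(uniformSphere E), ‖x‖ = 1 := by
  refine Measure.ae_smul_measure ?_ _
  rw [ae_map_iff measurable_subtype_coe.aemeasurable
    (measurableSet_eq_fun measurable_norm measurable_const)]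
  exact .of_forall fun x => by simp

lemma uniformSphere_map (e : E ≃ₗᵢ[ℝ] E) : (uniformSphere E).map e = uniformSphere E := by
  rw [uniformSphere, Measure.map_smul]
  congr 1
  ext A hA
  have he : Measurable e := e.continuous.measurable
  rw [Measure.map_apply he hA, Measure.map_apply measurable_subtype_coe (he hA),
    Measure.map_apply measurable_subtype_coe hA,
    Measure.toSphere_apply' _ (measurable_subtype_coe (he hA)),
    Measure.toSphere_apply' _ (measurable_subtype_coe hA)]
  conv_rhs => rw [← e.measurePreserving.measure_preimage_equiv (f := e.toMeasurableEquiv)]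
  congr 2
  ext x
  simp only [Set.mem_smul, mem_image, mem_preimage, LinearIsometryEquiv.coe_toMeasurableEquiv]
  constructor
  · rintro ⟨c, hc, _, ⟨y, hy, rfl⟩, rfl⟩
    exact ⟨c, hc, e y, ⟨⟨e y, by simp⟩, hy, rfl⟩, by simp⟩
  · rintro ⟨c, hc, _, ⟨y, hy, rfl⟩, hx⟩
    refine ⟨c, hc, e.symm y, ⟨⟨e.symm y, by simp⟩, by simpa using hy, rfl⟩, ?_⟩
    apply e.injective
    simpa using hx

/-- Integration in polar coordinates over the unit ball. -/
lemma setLIntegral_ball_eq_polar [Nontrivial E] {F : E → ℝ≥0∞} (hF : Measurable F) :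
    ∫⁻ x in ball (0 : E) 1, F x = Module.finrank ℝ E * volume (ball (0 : E) 1) *
      ∫⁻ r in Ioo (0 : ℝ) 1, ENNReal.ofReal (r ^ (Module.finrank ℝ E - 1)) *
        ∫⁻ θ, F (r • θ) ∂(uniformSphere E) := by
  set d := Module.finrank ℝ E
  set S := (volume : Measure E).toSphere
  have hS0 : S univ ≠ 0 := Measure.measure_univ_ne_zero.2 (volume : Measure E).toSphere_ne_zero
  have hStop : S univ ≠ ∞ := measure_ne_top _ _
  have hG : ∀ r : ℝ, ∫⁻ θ : sphere (0 : E) 1, F (r • (θ : E)) ∂S =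
      S univ * ∫⁻ θ, F (r • θ) ∂(uniformSphere E) := by
    intro r
    rw [uniformSphere, lintegral_smul_measure,
      lintegral_map (by fun_prop) measurable_subtype_coe, smul_eq_mul, ← mul_assoc,
      ENNReal.mul_inv_cancel hS0 hStop, one_mul]
  set F' : E → ℝ≥0∞ := (ball (0 : E) 1).indicator F
  have hF' : Measurable F' := hF.indicator measurableSet_ball
  have hind : ∀ r ∈ Ioi (0 : ℝ), ∀ θ : sphere (0 : E) 1,
      F' (r • (θ : E)) = (Iio (1 : ℝ)).indicator (fun r => F (r • (θ : E))) r := by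
    intro r hr θ
    have : ‖r • (θ : E)‖ = r := by simp [norm_smul, abs_of_pos (mem_Ioi.1 hr)]
    simp only [F', indicator, mem_ball_zero_iff, this, mem_Iio]
  calc ∫⁻ x in ball (0 : E) 1, F x = ∫⁻ x, F' x := (lintegral_indicator measurableSet_ball _).symm
    _ = ∫⁻ x : ({0}ᶜ : Set E), F' x ∂((volume : Measure E).comap (↑)) := by
      rw [lintegral_subtype_comap (measurableSet_singleton _).compl F', restrict_compl_singleton]
    _ = ∫⁻ p, F' (p.2.1 • (p.1 : E)) ∂(S.prod (.volumeIoiPow (d - 1))) := by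
      have h := (volume : Measure E).measurePreserving_homeomorphUnitSphereProd
      rw [← h.lintegral_comp (by fun_prop)]
      refine lintegral_congr fun x => ?_
      congr 1
      exact congrArg Subtype.val ((homeomorphUnitSphereProd E).symm_apply_apply x).symm
    _ = ∫⁻ r : Ioi (0 : ℝ), ∫⁻ θ, F' (r.1 • (θ : E)) ∂S ∂(.volumeIoiPow (d - 1)) :=
      lintegral_prod_symm _ (by fun_prop)
    _ = ∫⁻ r in Ioi (0 : ℝ), ENNReal.ofReal (r ^ (d - 1)) * ∫⁻ θ, F' (r • (θ : E)) ∂S := by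
      rw [Measure.volumeIoiPow, lintegral_withDensity_eq_lintegral_mul _ (by fun_prop)]
      · exact lintegral_subtype_comap measurableSet_Ioi
          (fun r : ℝ => ENNReal.ofReal (r ^ (d - 1)) * ∫⁻ θ, F' (r • (θ : E)) ∂S)
      · exact Measurable.lintegral_prod_right'
          (f := fun p : Ioi (0 : ℝ) × sphere (0 : E) 1 => F' (p.1.1 • (p.2 : E)))
          (hF'.comp (by fun_prop))
    _ = ∫⁻ r in Ioi (0 : ℝ), (Iio (1 : ℝ)).indicator (fun r => ENNReal.ofReal (r ^ (d - 1)) *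
          ∫⁻ θ : sphere (0 : E) 1, F (r • (θ : E)) ∂S) r := by
      refine setLIntegral_congr_fun measurableSet_Ioi fun r hr => ?_
      simp only [hind r hr, indicator]
      split_ifs <;> simp
    _ = ∫⁻ r in Ioo (0 : ℝ) 1, ENNReal.ofReal (r ^ (d - 1)) *
          ∫⁻ θ : sphere (0 : E) 1, F (r • (θ : E)) ∂S := by
      rw [lintegral_indicator measurableSet_Iio, Measure.restrict_restrict measurableSet_Iio,
        inter_comm, Ioi_inter_Iio]
    _ = _ := by
      rw [← Measure.toSphere_apply_univ, ← lintegral_const_mul' _ _ hStop]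
      refine lintegral_congr fun r => ?_
      rw [hG, mul_left_comm]

end Sphere

section Convex

/-- A monotone convex `Φ` with `Φ 0 < Φ t` dominates an affine function of positive slope that
takes the value `Φ t` at a prescribed point `t' > t` where `Φ` is finite. -/
lemma exists_affine_le {Φ : ℝ≥0∞ → ℝ≥0∞} (hmono : Monotone Φ)
    (hconv : ∀ (a : ℝ≥0), a ≤ 1 → ∀ t₁ t₂ : ℝ≥0∞,
      Φ (a • t₁ + (1 - a) • t₂) ≤ a • Φ t₁ + (1 - a) • Φ t₂)
    {t t' : ℝ≥0} (htt' : t < t') (h0 : Φ 0 < Φ t) (hfin : Φ t' ≠ ∞) :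
    ∃ p : ℝ≥0, p ≠ 0 ∧ ∀ u : ℝ≥0∞, Φ t + p * u ≤ Φ u + p * t' := by
  have hmono' : ∀ {a b : ℝ≥0}, a ≤ b → Φ a ≤ Φ b := fun h => hmono (by exact_mod_cast h)
  -- the three-point form of convexity
  have three : ∀ {x y z : ℝ≥0}, x ≤ y → y ≤ z → x < z → Φ z ≠ ∞ →
      (Φ y).toReal * (z - x) ≤ (Φ x).toReal * (z - y) + (Φ z).toReal * (y - x) := by
    intro x y z hxy hyz hxz hz
    have hx : Φ x ≠ ∞ := ne_top_of_le_ne_top hz (hmono' hxz.le)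
    have hy : Φ y ≠ ∞ := ne_top_of_le_ne_top hz (hmono' hyz)
    have hxzR : (0 : ℝ) < z - x := sub_pos.2 (by exact_mod_cast hxz)
    have hxyR : (x : ℝ) ≤ y := by exact_mod_cast hxy
    have hyzR : (y : ℝ) ≤ z := by exact_mod_cast hyz
    let a : ℝ≥0 := ⟨(z - y) / (z - x), div_nonneg (sub_nonneg.2 hyzR) hxzR.le⟩
    have haR : (a : ℝ) = (z - y) / (z - x) := rfl
    have ha1 : a ≤ 1 := by
      rw [← NNReal.coe_le_coe, haR, NNReal.coe_one, div_le_one hxzR]; linarith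
    have hbR : ((1 - a : ℝ≥0) : ℝ) = (y - x) / (z - x) := by
      rw [NNReal.coe_sub ha1, haR]; field_simp; simp
    have hcomb : a • (x : ℝ≥0∞) + (1 - a) • (z : ℝ≥0∞) = y := by
      rw [ENNReal.smul_def, ENNReal.smul_def, smul_eq_mul, smul_eq_mul]
      norm_cast
      rw [← NNReal.coe_inj]
      push_cast [hbR]
      rw [haR]; field_simp; ring
    have h := hconv a ha1 x z
    rw [hcomb, ENNReal.smul_def, ENNReal.smul_def, smul_eq_mul, smul_eq_mul] at h
    have h' := ENNReal.toReal_mono (by finiteness) h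
    rw [ENNReal.toReal_add (by finiteness) (by finiteness), ENNReal.toReal_mul,
      ENNReal.toReal_mul, ENNReal.coe_toReal, ENNReal.coe_toReal, hbR, haR] at h'
    calc _ ≤ _ := mul_le_mul_of_nonneg_right h' hxzR.le
      _ = _ := by field_simp
  have htfin : Φ t ≠ ∞ := ne_top_of_le_ne_top hfin (hmono' htt'.le)
  have httR : (t : ℝ) < t' := by exact_mod_cast htt'
  have h0R : (Φ 0).toReal < (Φ t).toReal := ENNReal.toReal_strict_mono htfin h0
  have ht'R : (Φ t).toReal < (Φ t').toReal := by
    have h := three (x := 0) (zero_le) htt'.le (bot_lt_of_lt htt') hfin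
    simp only [NNReal.coe_zero, sub_zero, ENNReal.coe_zero] at h
    have : (0 : ℝ) < t' - t := sub_pos.2 httR
    have ht0 : (0 : ℝ) < t := by
      rcases eq_or_ne t 0 with rfl | ht
      · simp at h0
      · exact_mod_cast pos_iff_ne_zero.2 ht
    by_contra hle
    nlinarith
  let p : ℝ≥0 := ⟨((Φ t').toReal - (Φ t).toReal) / (t' - t),
    div_nonneg (sub_nonneg.2 ht'R.le) (sub_nonneg.2 httR.le)⟩
  have hpR : (p : ℝ) * (t' - t) = (Φ t').toReal - (Φ t).toReal :=
    div_mul_cancel₀ _ (sub_pos.2 httR).ne'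
  have hp0 : (0 : ℝ) < p := div_pos (sub_pos.2 ht'R) (sub_pos.2 httR)
  refine ⟨p, fun h => by simp [h] at hp0, fun u => ?_⟩
  rcases eq_or_ne (Φ u) ∞ with hu | hu
  · simp [hu]
  have hutop : u ≠ ∞ := by
    rintro rfl
    -- convexity between `0` and `∞`
    have h := hconv 2⁻¹ (by simp [← NNReal.coe_le_coe]; norm_num) 0 ∞
    have h2 : (1 - 2⁻¹ : ℝ≥0) = 2⁻¹ := by
      rw [← NNReal.coe_inj, NNReal.coe_sub (by simp [← NNReal.coe_le_coe]; norm_num)]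
      norm_num
    simp only [h2, smul_zero, zero_add, ENNReal.smul_def, smul_eq_mul] at h
    rw [ENNReal.mul_top (by simp)] at h
    have h' := ENNReal.toReal_mono (by finiteness) h
    rw [ENNReal.toReal_add (by finiteness) (by finiteness), ENNReal.toReal_mul,
      ENNReal.toReal_mul] at h'
    simp at h'
    have := ENNReal.toReal_mono hu (hmono (le_top : (t : ℝ≥0∞) ≤ ∞))
    linarith
  lift u to ℝ≥0 using hutop
  have hreal : (Φ t).toReal + p * u ≤ (Φ u).toReal + p * t' := by
    rcases le_total u t with hut | hut
    · have h := three hut htt'.le (hut.trans_lt htt') hfin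
      have hutR : (u : ℝ) ≤ t := by exact_mod_cast hut
      have h1 : (Φ t).toReal * (t' - t) ≤ ((Φ u).toReal + p * (t - u)) * (t' - t) := by
        nlinarith
      have := le_of_mul_le_mul_right h1 (sub_pos.2 httR)
      nlinarith
    · have hm := ENNReal.toReal_mono hu (hmono' hut)
      rcases le_total u t' with hut' | hut'
      · have : (u : ℝ) ≤ t' := by exact_mod_cast hut'
        nlinarith
      · have h := three htt'.le hut' (htt'.trans_le hut') hu
        have hutR : (t' : ℝ) ≤ u := by exact_mod_cast hut'
        have h1 : ((Φ t).toReal + p * (u - t)) * (t' - t) ≤ (Φ u).toReal * (t' - t) := by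
          nlinarith
        have := le_of_mul_le_mul_right h1 (sub_pos.2 httR)
        nlinarith
  rw [← ENNReal.toReal_le_toReal (by finiteness) (by finiteness),
    ENNReal.toReal_add (by finiteness) (by finiteness),
    ENNReal.toReal_add (by finiteness) (by finiteness)]
  simpa using hreal

/-- A Jensen-type inequality for the generalized inverse of a monotone convex function. -/
lemma lintegral_le_genInv {α : Type*} [MeasurableSpace α] {σ : Measure α}
    [IsProbabilityMeasure σ] {Φ : ℝ≥0∞ → ℝ≥0∞} (hmono : Monotone Φ)
    (hconv : ∀ (a : ℝ≥0), a ≤ 1 → ∀ t₁ t₂ : ℝ≥0∞,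
      Φ (a • t₁ + (1 - a) • t₂) ≤ a • Φ t₁ + (1 - a) • Φ t₂)
    {f : α → ℝ≥0∞} (hf : Measurable f) {τ : ℝ≥0∞} (hτ : τ ≠ ∞) (h0 : Φ 0 < τ)
    (hle : ∫⁻ x, Φ (f x) ∂σ ≤ τ) : ∫⁻ x, f x ∂σ ≤ genInv Φ τ := by
  by_contra! hlt
  obtain ⟨t, ht, htm⟩ := ENNReal.lt_iff_exists_nnreal_btwn.1 hlt
  obtain ⟨t', htt', ht'm⟩ := ENNReal.lt_iff_exists_nnreal_btwn.1 htm
  have hτt : τ ≤ Φ t := by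
    obtain ⟨u, hu, hut⟩ := sInf_lt_iff.1 ht
    exact le_trans hu (hmono hut.le)
  refine ht'm.not_ge ?_
  have hΦf : Measurable fun x => Φ (f x) := hmono.measurable.comp hf
  rcases eq_or_ne (Φ t') ∞ with hinf | hfin
  · have hae := ae_lt_top hΦf (ne_top_of_le_ne_top hτ hle)
    calc ∫⁻ x, f x ∂σ ≤ ∫⁻ _, t' ∂σ := lintegral_mono_ae <| hae.mono fun x hx => by
          by_contra! h
          exact hx.not_ge (hinf ▸ hmono h.le)
      _ = t' := by simp
  · obtain ⟨p, hp, haff⟩ := exists_affine_le hmono hconv (by exact_mod_cast htt')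
      (h0.trans_le hτt) hfin
    have hint := lintegral_mono (μ := σ) fun x => haff (f x)
    rw [lintegral_add_left measurable_const, lintegral_add_left hΦf,
      lintegral_const_mul _ hf] at hint
    simp only [lintegral_const, measure_univ, mul_one] at hint
    have h1 : Φ t + p * ∫⁻ x, f x ∂σ ≤ Φ t + p * t' :=
      hint.trans (by gcongr; exact hle.trans hτt)
    have htfin : Φ t ≠ ∞ := ne_top_of_le_ne_top hfin (hmono htt'.le)
    have h2 := (ENNReal.add_le_add_iff_left htfin).1 h1
    exact (ENNReal.mul_le_mul_iff_right (by exact_mod_cast hp) ENNReal.coe_ne_top).1 h2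

end Convex

lemma sphereAvg_le_lintegral_uniformSphere {n : ℕ} [Nontrivial (EuclideanSpace ℝ (Fin n))]
    {K : EuclideanSpace ℝ (Fin n) → ℝ≥0∞} (hK : Measurable K) {r : ℝ} (hr : 0 < r) :
    sphereAvg n K r ≤ ∫⁻ θ, K (r • θ) ∂(uniformSphere (EuclideanSpace ℝ (Fin n))) := by
  let E := EuclideanSpace ℝ (Fin n)
  set μ : Measure E := (μH[(n : ℝ) - 1]).restrict (sphere 0 r)
  have hμuniv : μ univ = μH[(n : ℝ) - 1] (sphere (0 : E) r) := Measure.restrict_apply_univ _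
  have havg : sphereAvg n K r = (μ univ)⁻¹ * ∫⁻ x, K x ∂μ := by
    rw [sphereAvg, ENNReal.div_eq_inv_mul, hμuniv]
  rcases eq_or_ne (μ univ) ∞ with htop | htop
  · simp [havg, htop]
  rcases eq_or_ne (μ univ) 0 with hzero | hzero
  · simp [havg, Measure.measure_univ_eq_zero.1 hzero]
  have hprob : IsProbabilityMeasure ((μ univ)⁻¹ • μ) :=
    ⟨by simp [ENNReal.inv_mul_cancel hzero htop]⟩
  have hsmul : Measurable fun x : E => r • x := measurable_const_smul r
  have hprob' : IsProbabilityMeasure ((uniformSphere E).map (r • ·)) :=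
    Measure.isProbabilityMeasure_map hsmul.aemeasurable
  have heq : (μ univ)⁻¹ • μ = (uniformSphere E).map (r • ·) := by
    refine eq_of_map_linearIsometryEquiv_eq (fun e => ?_) (fun e => ?_) hr ?_ ?_
    · rw [Measure.map_smul]
      congr 1
      have h := (e.toIsometryEquiv.measurePreserving_hausdorffMeasure
        ((n : ℝ) - 1)).restrict_preimage (s := sphere (0 : E) r) isClosed_sphere.measurableSet
      have hpre : e.toIsometryEquiv ⁻¹' sphere (0 : E) r = sphere 0 r := by ext; simp
      rw [hpre] at h
      exact h.map_eq
    · have he : Measurable e := e.continuous.measurable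
      conv_rhs => rw [← uniformSphere_map e]
      rw [Measure.map_map he hsmul, Measure.map_map hsmul he]
      congr 1
      ext1 x
      simp
    · refine Measure.ae_smul_measure ?_ _
      filter_upwards [ae_restrict_mem isClosed_sphere.measurableSet] with x hx
      simpa using hx
    · rw [ae_map_iff hsmul.aemeasurable (measurableSet_eq_fun measurable_norm measurable_const)]
      filter_upwards [ae_uniformSphere_norm_eq_one (E := E)] with x hx
      simp [norm_smul, hx, abs_of_pos hr]
  rw [havg, ← smul_eq_mul, ← lintegral_smul_measure, heq, lintegral_map hK hsmul]

/-- Let `n ≥ 2`, `K : 𝔹ⁿ → [0,∞]` measurable, `Φ : [0,∞] → [0,∞]`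
non-decreasing and convex with `Φ(0) > 0`, and suppose `M = (1/Ω_n) ∫_{𝔹ⁿ} Φ(K(x)) dm(x)`
is finite. Then there is a measurable set `T* ⊂ (0,∞)` with `|T*| ≤ 1/n` such that
`k(e^{-s}) ≤ Φ⁻¹(e^{ns} M)` for all `s ∈ (0,∞) \ T*`. -/
theorem stmt_2 (n : ℕ) (hn : 2 ≤ n)
    (K : EuclideanSpace ℝ (Fin n) → ℝ≥0∞) (hK : Measurable K)
    (Φ : ℝ≥0∞ → ℝ≥0∞) (hΦmono : Monotone Φ)
    (hΦconv : ∀ (a : ℝ≥0), a ≤ 1 → ∀ t₁ t₂ : ℝ≥0∞,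
      Φ (a • t₁ + (1 - a) • t₂) ≤ a • Φ t₁ + (1 - a) • Φ t₂)
    (hΦ0 : 0 < Φ 0)
    (M : ℝ≥0∞)
    (hM : M = (∫⁻ x in Metric.ball (0 : EuclideanSpace ℝ (Fin n)) 1, Φ (K x)) /
      volume (Metric.ball (0 : EuclideanSpace ℝ (Fin n)) 1))
    (hMfin : M ≠ ∞) :
    ∃ T : Set ℝ, MeasurableSet T ∧ T ⊆ Set.Ioi (0 : ℝ) ∧ volume T ≤ (n : ℝ≥0∞)⁻¹ ∧
      ∀ s ∈ Set.Ioi (0 : ℝ) \ T,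
        sphereAvg n K (Real.exp (-s)) ≤ genInv Φ (ENNReal.ofReal (Real.exp (n * s)) * M) := by
  have hn0 : n ≠ 0 := by omega
  have : Nonempty (Fin n) := ⟨⟨0, by omega⟩⟩
  let E := EuclideanSpace ℝ (Fin n)
  have hdim : Module.finrank ℝ E = n := finrank_euclideanSpace_fin
  set B := volume (ball (0 : E) 1)
  have hB0 : B ≠ 0 := (measure_ball_pos _ _ one_pos).ne'
  have hBtop : B ≠ ∞ := measure_ball_lt_top.ne
  have hnE0 : (n : ℝ≥0∞) ≠ 0 := by exact_mod_cast hn0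
  have hnEtop : (n : ℝ≥0∞) ≠ ∞ := ENNReal.natCast_ne_top n
  have hΦK : Measurable fun x => Φ (K x) := hΦmono.measurable.comp hK
  have hΦ0M : Φ 0 ≤ M := by
    rw [hM, ENNReal.le_div_iff_mul_le (.inl hB0) (.inl hBtop), ← setLIntegral_const]
    exact lintegral_mono fun x => hΦmono zero_le
  have hM0 : M ≠ 0 := (hΦ0.trans_le hΦ0M).ne'
  let g : ℝ → ℝ≥0∞ := fun r => ∫⁻ θ, Φ (K (r • θ)) ∂(uniformSphere E)
  have hg : Measurable g :=
    Measurable.lintegral_prod_right' (f := fun p : ℝ × E => Φ (K (p.1 • p.2)))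
      (hΦK.comp measurable_smul)
  have hexp : Measurable fun s : ℝ => Real.exp (-s) := by fun_prop
  -- the mean value `M` in logarithmic polar coordinates
  have hMint : M = n * ∫⁻ s in Ioi (0 : ℝ),
      ENNReal.ofReal (Real.exp (-(n * s))) * g (Real.exp (-s)) := by
    have himage : (fun s : ℝ => Real.exp (-s)) '' Ioi 0 = Ioo 0 1 := by
      ext r
      constructor
      · rintro ⟨s, hs, rfl⟩
        exact ⟨Real.exp_pos _, by simpa using hs⟩
      · rintro ⟨h0, h1⟩
        exact ⟨-Real.log r, by simpa using Real.log_neg h0 h1, by simp [Real.exp_log h0]⟩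
    have hderiv : ∀ s ∈ Ioi (0 : ℝ),
        HasDerivWithinAt (fun s : ℝ => Real.exp (-s)) (-Real.exp (-s)) (Ioi 0) s := by
      intro s _
      simpa using (hasDerivAt_neg s).exp.hasDerivWithinAt
    rw [hM, setLIntegral_ball_eq_polar hΦK, hdim, ← himage,
      lintegral_image_eq_lintegral_abs_deriv_mul measurableSet_Ioi hderiv
        (fun a _ b _ h => by simpa using h),
      mul_right_comm, mul_div_assoc, ENNReal.div_self hB0 hBtop, mul_one]
    congr 1
    refine lintegral_congr fun s => ?_
    rw [abs_neg, abs_of_pos (Real.exp_pos _), ← mul_assoc, ← ENNReal.ofReal_mul (by positivity),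
      ← pow_succ', Nat.sub_add_cancel (by omega), ← Real.exp_nat_mul, mul_neg]
  set T := {s | s ∈ Ioi (0 : ℝ) ∧ ENNReal.ofReal (Real.exp (n * s)) * M < g (Real.exp (-s))}
  have hT : MeasurableSet T :=
    measurableSet_Ioi.inter (measurableSet_lt (by fun_prop) (hg.comp hexp))
  refine ⟨T, hT, fun s hs => hs.1, ?_, ?_⟩
  · have hle : n * (M * volume T) ≤ M := by
      conv_rhs => rw [hMint]
      gcongr
      calc M * volume T = ∫⁻ _ in T, M := (setLIntegral_const _ _).symm
        _ ≤ ∫⁻ s in T, ENNReal.ofReal (Real.exp (-(n * s))) * g (Real.exp (-s)) := by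
          refine setLIntegral_mono' hT fun s hs => ?_
          calc M = ENNReal.ofReal (Real.exp (-(n * s))) *
                (ENNReal.ofReal (Real.exp (n * s)) * M) := by
                rw [← mul_assoc, ← ENNReal.ofReal_mul (by positivity), ← Real.exp_add]
                simp
            _ ≤ _ := by gcongr; exact hs.2.le
        _ ≤ _ := lintegral_mono_set fun s hs => hs.1
    rw [← ENNReal.mul_le_mul_iff_right hM0 hMfin, ← ENNReal.mul_le_mul_iff_right hnE0 hnEtop]
    calc n * (M * volume T) ≤ M := hle
      _ = n * (M * (n : ℝ≥0∞)⁻¹) := by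
        rw [mul_left_comm, ENNReal.mul_inv_cancel hnE0 hnEtop, mul_one]
  · rintro s ⟨hs, hsT⟩
    have hs0 : (0 : ℝ) < s := hs
    have hgle : g (Real.exp (-s)) ≤ ENNReal.ofReal (Real.exp (n * s)) * M :=
      not_lt.1 fun h => hsT ⟨hs, h⟩
    refine (sphereAvg_le_lintegral_uniformSphere hK (Real.exp_pos _)).trans
      (lintegral_le_genInv hΦmono hΦconv (hK.comp (measurable_const_smul _)) (by finiteness) ?_
        hgle)
    refine hΦ0M.trans_lt ?_
    conv_lhs => rw [← one_mul M]
    refine (ENNReal.mul_lt_mul_iff_left hM0 hMfin).2 ?_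
    rw [ENNReal.one_lt_ofReal, Real.one_lt_exp_iff]
    positivity
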